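/- Let d ∈ N, s > d/2 and 0 < r < ∞. Then lim_{n→∞} n^{s/d − 1/2} · a_n(I_d : H^{s,r}(T^d) → L∞(T^d)) = √(d/(2s−d)) · vol(B_r^d)^{s/d}, where I_d denotes the embedding of H^{s,r}(T^d) into L∞(T^d). The same limit holds when L∞(T^d) is replaced by C(T^d) or by the Wiener algebra A(T^d). -/

import Mathlib

open MeasureTheory Filter
open scoped ENNReal NNReal

noncomputable section

/-- The index lattice `ℤ^d`. -/
abbrev ZLat (d : ℕ) := Fin d → ℤ

instance fact_two_pi_pos : Fact (0 < 2 * Real.pi) := ⟨by positivity⟩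

/-- The `d`-dimensional torus `𝕋^d = [0,2π]^d` with endpoints identified. -/
abbrev Torus (d : ℕ) := Fin d → AddCircle (2 * Real.pi)

/-- The normalized Lebesgue measure `(2π)^{-d} dx` on the `d`-torus. -/
def torusMeasure (d : ℕ) : Measure (Torus d) :=
  ((ENNReal.ofReal (2 * Real.pi))⁻¹) ^ d • Measure.pi fun _ => volume

/-- The character `e^{i k·x}` on the `d`-torus. -/
def torusChar {d : ℕ} (k : ZLat d) (x : Torus d) : ℂ :=
  ∏ j, fourier (k j) (x j)

/-- The `k`-th Fourier coefficient `f̂(k) = (2π)^{-d} ∫_{𝕋^d} f(x) e^{-i k·x} dx`. -/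
def fourierCoef {d : ℕ} (f : Torus d → ℂ) (k : ZLat d) : ℂ :=
  ∫ x, (starRingEnd ℂ) (torusChar k x) * f x ∂(torusMeasure d)

/-- The `n`-th approximation number of a bounded linear operator `T`:
`a_n(T) = inf {‖T - A‖ : rank A < n}`. -/
def approxNum {X Y : Type*} [NormedAddCommGroup X] [NormedSpace ℂ X]
    [NormedAddCommGroup Y] [NormedSpace ℂ Y] (T : X →L[ℂ] Y) (n : ℕ) : ℝ :=
  sInf {c : ℝ | ∃ A : X →L[ℂ] Y,
    Module.rank ℂ (LinearMap.range (A : X →ₗ[ℂ] Y)) < n ∧ c = ‖T - A‖}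

/-- `ℓ²(ℤ^d)`; an isometric model of the Hilbert space `F_d(w)` via `f ↦ (w(k)·f̂(k))_k`.
Under this identification the embedding `I_d : F_d(w) → G` is characterized by the
property that the function `T c` has Fourier coefficients `c(k)/w(k)`. -/
abbrev ellTwo (d : ℕ) := lp (fun _ : ZLat d => ℂ) 2

/-- `ℓ¹(ℤ^d)`; an isometric model of the Wiener algebra `A(𝕋^d)` via `f ↦ (f̂(k))_k`. -/
abbrev ellOne (d : ℕ) := lp (fun _ : ZLat d => ℂ) 1

/-- `ℓ^∞(ℤ^d)`; an isometric model of the space `ℬ(𝕋^d)` of distributions with bounded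
Fourier coefficients. -/
abbrev ellInfty (d : ℕ) := lp (fun _ : ZLat d => ℂ) ⊤

/-- The weight `w_{s,r}(k) = (1 + ∑_j |k_j|^r)^{s/r}` of the isotropic Sobolev space
`H^{s,r}(𝕋^d) = F_d(w_{s,r})`. -/
def wIso (d : ℕ) (s r : ℝ) (k : ZLat d) : ℝ := (1 + ∑ j, |(k j : ℝ)| ^ r) ^ (s / r)

/-- A real function with finite sublevel sets on a countably infinite type can be arranged
in nondecreasing order. -/
theorem exists_equiv_nat_monotone {α : Type*} [Countable α] [Infinite α] (w : α → ℝ)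
    (hw : ∀ t, {a | w a ≤ t}.Finite) : ∃ e : ℕ ≃ α, Monotone fun j => w (e j) := by
  classical
  obtain ⟨c, hc⟩ := exists_injective_nat α
  let φ : α → ℝ ×ₗ ℕ := fun a => toLex (w a, c a)
  have hφ : Function.Injective φ := fun a b h => hc (congrArg Prod.snd (toLex.injective h))
  let _ : LinearOrder α := LinearOrder.lift' φ hφ
  have hle : ∀ a b : α, a ≤ b → w a ≤ w b := fun a b h => by
    rcases (Prod.Lex.le_iff (x := φ a) (y := φ b)).1 h with h | h
    · exact h.le
    · exact h.1.le
  have hIic : ∀ b : α, (Set.Iic b).Finite := fun b =>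
    (hw (w b)).subset fun a ha => hle a b ha
  let _ : LocallyFiniteOrder α := LocallyFiniteOrder.ofFiniteIcc fun a b =>
    (hIic b).subset Set.Icc_subset_Iic_self
  have : NoMaxOrder α := ⟨fun a => by
    by_contra! h
    exact Set.infinite_univ ((hIic a).subset fun b _ => h b)⟩
  have a₀ : α := Classical.arbitrary α
  obtain ⟨m, hm⟩ := (hIic a₀).exists_minimal ⟨a₀, Set.mem_Iic.2 le_rfl⟩
  let _ : OrderBot α :=
    { bot := m
      bot_le := fun a => by
        rcases le_total a a₀ with h | h
        · rcases le_total m a with h' | h'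
          · exact h'
          · exact hm.2 h h'
        · exact le_trans hm.1 h }
  let _ := LinearLocallyFiniteOrder.succOrder α
  let _ := LinearLocallyFiniteOrder.predOrder α
  exact ⟨(orderIsoNatOfLinearSuccPredArch (ι := α)).symm.toEquiv, fun i j hij =>
    hle _ _ ((orderIsoNatOfLinearSuccPredArch (ι := α)).symm.monotone hij)⟩

/-- The increments of `n ↦ n^{1-p}/(p-1)` are asymptotic to `n^{-p}`. -/
theorem tendsto_rpow_mul_sub_rpow {p : ℝ} (hp : 1 < p) :
    Tendsto (fun n : ℕ => (n : ℝ) ^ p *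
      ((n : ℝ) ^ (1 - p) / (p - 1) - ((n + 1 : ℕ) : ℝ) ^ (1 - p) / (p - 1))) atTop (nhds 1) := by
  have hd : HasDerivAt (fun x : ℝ => x ^ (1 - p)) (1 - p) 1 := by
    simpa using Real.hasDerivAt_rpow_const (x := 1) (p := 1 - p) (Or.inl one_ne_zero)
  have h1 : Tendsto (fun n : ℕ => 1 + ((n : ℝ))⁻¹) atTop (nhdsWithin 1 {1}ᶜ) := by
    rw [tendsto_nhdsWithin_iff]
    refine ⟨by simpa using tendsto_inv_atTop_nhds_zero_nat (𝕜 := ℝ) |>.const_add 1, ?_⟩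
    filter_upwards [eventually_gt_atTop 0] with n hn
    have : (n : ℝ) ≠ 0 := by positivity
    simpa using hn.ne'
  have h2 := (hasDerivAt_iff_tendsto_slope.1 hd).comp h1 |>.div_const (1 - p)
  rw [div_self (by linarith)] at h2
  refine h2.congr' ?_
  filter_upwards [eventually_gt_atTop 0] with n hn
  have hn' : (0 : ℝ) < n := by positivity
  have e1 : ((n + 1 : ℕ) : ℝ) = n * (1 + (n : ℝ)⁻¹) := by push_cast; field_simp
  rw [e1, Real.mul_rpow hn'.le (by positivity), Function.comp_apply, slope_def_field,
    Real.one_rpow, add_sub_cancel_left, show (n : ℝ) ^ (1 - p) = n / (n : ℝ) ^ p by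
      rw [Real.rpow_sub hn', Real.rpow_one]]
  have : (n : ℝ) ^ p ≠ 0 := (Real.rpow_pos_of_pos hn' p).ne'
  have : 1 - p ≠ 0 := by linarith
  have : p - 1 ≠ 0 := by linarith
  field_simp
  ring

/-- If `f j ~ L j^{-p}` with `p > 1`, then `f` is summable and its tails satisfy
`∑_{j ≥ n} f j ~ L n^{1-p} / (p-1)`. -/
theorem tendsto_rpow_mul_tsum_tail {p L : ℝ} (hp : 1 < p) {f : ℕ → ℝ}
    (hf : Tendsto (fun n : ℕ => (n : ℝ) ^ p * f n) atTop (nhds L)) :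
    Summable f ∧
      Tendsto (fun n : ℕ => (n : ℝ) ^ (p - 1) * ∑' j, f (j + n)) atTop (nhds (L / (p - 1))) := by
  set g : ℕ → ℝ := fun n => (n : ℝ) ^ (1 - p) / (p - 1) with hg
  set h : ℕ → ℝ := fun n => g n - g (n + 1) with hh
  have hg0 : Tendsto g atTop (nhds 0) := by
    have := ((tendsto_rpow_neg_atTop (sub_pos.2 hp)).comp tendsto_natCast_atTop_atTop).div_const
      (p - 1)
    simpa [hg, Function.comp_def] using this
  have hmul := tendsto_rpow_mul_sub_rpow hp
  have hpos : ∀ n : ℕ, 0 < n → 0 < h n := fun n hn => by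
    have hn' : (0 : ℝ) < n := by positivity
    have : ((n + 1 : ℕ) : ℝ) ^ (1 - p) < (n : ℝ) ^ (1 - p) :=
      Real.rpow_lt_rpow_of_neg hn' (by push_cast; linarith) (by linarith)
    have := div_lt_div_of_pos_right this (sub_pos.2 hp)
    simp only [hh, hg]
    linarith
  have hsum : ∀ n, 0 < n → HasSum (fun j => h (j + n)) (g n) := fun n hn => by
    rw [hasSum_iff_tendsto_nat_of_nonneg (fun j => (hpos _ (by omega)).le)]
    have e : ∀ m, ∑ j ∈ Finset.range m, h (j + n) = g n - g (m + n) := fun m => by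
      have := Finset.sum_range_sub' (fun j => g (j + n)) m
      simp only [zero_add] at this
      rw [← this]
      refine Finset.sum_congr rfl fun j _ => ?_
      simp only [hh]
      rw [show j + n + 1 = j + 1 + n by ring]
    simp only [e]
    simpa using ((tendsto_add_atTop_iff_nat n).2 hg0).const_sub (g n)
  have hq : Tendsto (fun n => f n / h n) atTop (nhds L) := by
    have := hf.div hmul one_ne_zero
    rw [div_one] at this
    refine this.congr' ?_
    filter_upwards [eventually_gt_atTop 0] with n hn
    have hn' : (0 : ℝ) < n := by positivity
    exact mul_div_mul_left _ _ (Real.rpow_pos_of_pos hn' p).ne'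
  have hS : Summable f := by
    have h1 : Summable fun j => h (j + 1) := (hsum 1 one_pos).summable
    have h2 : Summable h := (summable_nat_add_iff 1).1 h1
    refine summable_of_isBigO_nat h2 ?_
    have := hq.isBigO_one ℝ
    refine Asymptotics.IsBigO.congr' (this.mul (Asymptotics.isBigO_refl h atTop)) ?_ (by simp)
    filter_upwards [eventually_gt_atTop 0] with n hn
    exact div_mul_cancel₀ _ (hpos n hn).ne'
  refine ⟨hS, ?_⟩
  have key : Tendsto (fun n => (∑' j, f (j + n)) / g n) atTop (nhds L) := by
    rw [Metric.tendsto_atTop] at hq ⊢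
    intro ε hε
    obtain ⟨N, hN⟩ := hq (ε / 2) (half_pos hε)
    refine ⟨max N 1, fun n hn => ?_⟩
    have hn0 : 0 < n := by have := le_max_right N 1; omega
    have hgn : 0 < g n := by
      have hn' : (0 : ℝ) < n := by positivity
      exact div_pos (Real.rpow_pos_of_pos hn' _) (sub_pos.2 hp)
    have hfs : Summable fun j => f (j + n) := (summable_nat_add_iff n).2 hS
    have hbd : ∀ j, (L - ε / 2) * h (j + n) ≤ f (j + n) ∧ f (j + n) ≤ (L + ε / 2) * h (j + n) :=
      fun j => by
        have hp' := hpos (j + n) (by omega)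
        have h3 := hN (j + n) (by have := le_max_left N 1; omega)
        rw [Real.dist_eq, abs_lt] at h3
        rw [← le_div_iff₀ hp', ← div_le_iff₀ hp']
        constructor <;> linarith [h3.1, h3.2]
    have hl := hasSum_le (fun j => (hbd j).1) ((hsum n hn0).mul_left _) hfs.hasSum
    have hu := hasSum_le (fun j => (hbd j).2) hfs.hasSum ((hsum n hn0).mul_left _)
    rw [← le_div_iff₀ hgn] at hl
    rw [← div_le_iff₀ hgn] at hu
    rw [Real.dist_eq, abs_lt]
    constructor <;> linarith
  refine (key.div_const (p - 1)).congr' ?_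
  filter_upwards [eventually_gt_atTop 0] with n hn
  have hn' : (0 : ℝ) < n := by positivity
  have : p - 1 ≠ 0 := by linarith
  have h4 : (n : ℝ) ^ (p - 1) ≠ 0 := (Real.rpow_pos_of_pos hn' _).ne'
  simp only [hg]
  rw [show 1 - p = -(p - 1) by ring, Real.rpow_neg hn'.le]
  field_simp

/-- Homogeneity of `x ↦ ∑ |x_j|^r`. -/
theorem sum_abs_smul_rpow {d : ℕ} (r : ℝ) {c : ℝ} (hc : 0 ≤ c) (x : Fin d → ℝ) :
    ∑ j, |(c • x) j| ^ r = c ^ r * ∑ j, |x j| ^ r := by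
  rw [Finset.mul_sum]
  refine Finset.sum_congr rfl fun j _ => ?_
  rw [Pi.smul_apply, smul_eq_mul, abs_mul, abs_of_nonneg hc, Real.mul_rpow hc (abs_nonneg _)]

theorem continuous_sum_abs_rpow (d : ℕ) {r : ℝ} (hr : 0 < r) :
    Continuous fun x : Fin d → ℝ => ∑ j, |x j| ^ r :=
  continuous_finsetSum _ fun j _ => (continuous_apply j).abs.rpow_const fun _ => Or.inr hr.le

theorem isBounded_sum_rpow_le_one (d : ℕ) {r : ℝ} (hr : 0 < r) :
    Bornology.IsBounded {x : Fin d → ℝ | ∑ j, |x j| ^ r ≤ 1} := by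
  refine (Metric.isBounded_closedBall (x := (0 : Fin d → ℝ)) (r := 1)).subset fun x hx => ?_
  rw [mem_closedBall_zero_iff, pi_norm_le_iff_of_nonneg zero_le_one]
  intro i
  have h1 : |x i| ^ r ≤ 1 :=
    (Finset.single_le_sum (f := fun j => |x j| ^ r) (fun j _ => by positivity)
      (Finset.mem_univ i)).trans hx
  rw [Real.norm_eq_abs]
  by_contra! h
  exact (Real.one_lt_rpow h hr).not_ge h1

/-- The unit sphere of `ℓ_r^d` is a Lebesgue null set. -/
theorem volume_sum_rpow_eq_one (d : ℕ) {r : ℝ} (hr : 0 < r) :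
    volume {x : Fin d → ℝ | ∑ j, |x j| ^ r = 1} = 0 := by
  set C : Set (Fin d → ℝ) := {x | ∑ j, |x j| ^ r ≤ 1}
  set U : Set (Fin d → ℝ) := {x | ∑ j, |x j| ^ r < 1}
  have hUC : U ⊆ C := fun x hx => le_of_lt (Set.mem_ofPred.1 hx)
  have hC : volume C ≠ ⊤ := (isBounded_sum_rpow_le_one d hr).measure_lt_top.ne
  have hU : volume U ≠ ⊤ := ne_top_of_le_ne_top hC (measure_mono hUC)
  have hle : ∀ t : ℝ, 1 < t → volume C ≤ ENNReal.ofReal (t ^ d) * volume U := fun t ht => by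
    have ht0 : 0 < t := by linarith
    have := Measure.addHaar_smul_of_nonneg (volume : Measure (Fin d → ℝ)) ht0.le U
    rw [Module.finrank_fin_fun] at this
    rw [← this]
    refine measure_mono fun x hx => ?_
    replace hx := Set.mem_ofPred.1 hx
    rw [Set.mem_smul_set_iff_inv_smul_mem₀ ht0.ne']
    change ∑ j, |(t⁻¹ • x) j| ^ r < 1
    rw [sum_abs_smul_rpow r (inv_nonneg.2 ht0.le)]
    have h1 : t⁻¹ ^ r < 1 := Real.rpow_lt_one (inv_nonneg.2 ht0.le) (inv_lt_one_of_one_lt₀ ht) hr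
    have h0 : 0 ≤ t⁻¹ ^ r := by positivity
    nlinarith
  have hlim : Tendsto (fun t : ℝ => ENNReal.ofReal (t ^ d) * volume U) (nhdsWithin 1 (Set.Ioi 1))
      (nhds (ENNReal.ofReal (1 ^ d) * volume U)) := by
    refine ENNReal.Tendsto.mul_const ?_ (Or.inr hU)
    exact (ENNReal.continuous_ofReal.comp (continuous_pow d)).continuousAt.tendsto.mono_left
      nhdsWithin_le_nhds
  have hCU : volume C ≤ volume U := by
    have := ge_of_tendsto hlim (eventually_nhdsWithin_of_forall fun t ht => hle t ht)
    simpa using this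
  have hUm : MeasurableSet U :=
    (isOpen_lt (continuous_sum_abs_rpow d hr) continuous_const).measurableSet
  have hd : volume (C \ U) = 0 := by
    rw [measure_sdiff hUC hUm.nullMeasurableSet hU, tsub_eq_zero_of_le hCU]
  refine measure_mono_null (fun x hx => ?_) hd
  exact ⟨(Set.mem_ofPred.1 hx).le, fun h => (Set.mem_ofPred.1 h).ne (Set.mem_ofPred.1 hx)⟩

theorem finite_setOf_sum_rpow_le (d : ℕ) {r : ℝ} (hr : 0 < r) (t : ℝ) :
    {k : ZLat d | (∑ j, |(k j : ℝ)| ^ r) ^ r⁻¹ ≤ t}.Finite := by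
  refine (Set.finite_Icc (fun _ => -⌈t⌉ : ZLat d) (fun _ => ⌈t⌉)).subset fun k hk => ?_
  have h : ∀ i, |k i| ≤ ⌈t⌉ := fun i => by
    have h1 : |(k i : ℝ)| ^ r ≤ ∑ j, |(k j : ℝ)| ^ r :=
      Finset.single_le_sum (f := fun j => |(k j : ℝ)| ^ r) (fun j _ => by positivity)
        (Finset.mem_univ i)
    have h2 := Real.rpow_le_rpow (by positivity) h1 (inv_nonneg.2 hr.le)
    rw [Real.rpow_rpow_inv (abs_nonneg _) hr.ne'] at h2
    have h3 : |(k i : ℝ)| ≤ ⌈t⌉ := (h2.trans hk).trans (Int.le_ceil t)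
    exact_mod_cast h3
  exact ⟨fun i => (abs_le.1 (h i)).1, fun i => (abs_le.1 (h i)).2⟩

open scoped Pointwise in
/-- The number of lattice points in the `ℓ_r`-ball of radius `y` is asymptotic to its volume. -/
theorem tendsto_card_lattice_div_pow (d : ℕ) {r : ℝ} (hr : 0 < r) :
    Tendsto (fun y : ℝ =>
      (Nat.card {k : ZLat d | (∑ j, |(k j : ℝ)| ^ r) ^ r⁻¹ ≤ y} : ℝ) / y ^ d) atTop
      (nhds (volume {x : Fin d → ℝ | ∑ j, |x j| ^ r ≤ 1}).toReal) := by
  set C : Set (Fin d → ℝ) := {x | ∑ j, |x j| ^ r ≤ 1} with hCdef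
  have hclosed : IsClosed C := isClosed_le (continuous_sum_abs_rpow d hr) continuous_const
  have h := tendsto_card_div_pow_atTop_volume' C (isBounded_sum_rpow_le_one d hr)
    hclosed.measurableSet ?_ ?_
  · rw [Fintype.card_fin] at h
    refine h.congr' ?_
    filter_upwards [eventually_gt_atTop 0] with y hy
    congr 2
    let φ : ZLat d → (Fin d → ℝ) := fun k => y⁻¹ • fun j => (k j : ℝ)
    have hφ : Function.Injective φ := fun a b hab => by
      have := smul_right_injective (Fin d → ℝ) (inv_ne_zero hy.ne') hab
      exact funext fun j => by exact_mod_cast congrFun this j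
    rw [← Nat.card_image_of_injective hφ]
    congr 1
    congr 1
    ext x
    have hmem : ∀ v : Fin d → ℝ,
        v ∈ Submodule.span ℤ (Set.range (Pi.basisFun ℝ (Fin d))) ↔
          ∃ k : ZLat d, (fun j => (k j : ℝ)) = v := fun v => by
      rw [Module.Basis.mem_span_iff_repr_mem]
      simp only [Pi.basisFun_repr, Set.mem_range, eq_intCast]
      rw [Classical.skolem]
      exact exists_congr fun k => funext_iff.symm
    have hiff : ∀ k : ZLat d, φ k ∈ C ↔ (∑ j, |(k j : ℝ)| ^ r) ^ r⁻¹ ≤ y := fun k => by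
      change ∑ j, |(y⁻¹ • fun j => (k j : ℝ)) j| ^ r ≤ 1 ↔ _
      rw [sum_abs_smul_rpow r (inv_nonneg.2 hy.le), Real.rpow_inv_le_iff_of_pos (by positivity)
        hy.le hr, Real.inv_rpow hy.le, inv_mul_le_iff₀ (by positivity), mul_one]
    constructor
    · rintro ⟨hxC, hx⟩
      rw [Set.mem_smul_set] at hx
      obtain ⟨v, hv, rfl⟩ := hx
      obtain ⟨k, rfl⟩ := (hmem v).1 hv
      exact ⟨k, (hiff k).1 hxC, rfl⟩
    · rintro ⟨k, hk, rfl⟩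
      exact ⟨(hiff k).2 hk, Set.smul_mem_smul_set ((hmem _).2 ⟨k, rfl⟩)⟩
  · refine measure_mono_null (fun x hx => ?_) (volume_sum_rpow_eq_one d hr)
    exact frontier_le_subset_eq (continuous_sum_abs_rpow d hr) continuous_const hx
  · rintro x y hx hxy _ ⟨z, hz, rfl⟩
    have hy : 0 < y := hx.trans_le hxy
    rw [Set.mem_smul_set_iff_inv_smul_mem₀ hy.ne']
    change ∑ j, |(y⁻¹ • x • z) j| ^ r ≤ 1
    rw [smul_smul, sum_abs_smul_rpow r (by positivity)]
    have h1 : (y⁻¹ * x) ^ r ≤ 1 := Real.rpow_le_one (by positivity)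
      (by rw [inv_mul_le_iff₀ hy]; linarith) hr.le
    exact mul_le_one₀ h1 (by positivity) hz

/-- The nondecreasing rearrangement of a function with counting function `∼ V y^d`. -/
theorem tendsto_div_pow_of_tendsto_card {α : Type*} {d : ℕ} {ρ : α → ℝ} {V : ℝ}
    (hfin : ∀ t, {a | ρ a ≤ t}.Finite)
    (hcard : Tendsto (fun y : ℝ => (Nat.card {a | ρ a ≤ y} : ℝ) / y ^ d) atTop (nhds V))
    (e : ℕ ≃ α) (he : Monotone fun j => ρ (e j)) :
    Tendsto (fun j => ρ (e j)) atTop atTop ∧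
      Tendsto (fun j : ℕ => (j : ℝ) / ρ (e j) ^ d) atTop (nhds V) := by
  have htop : Tendsto (fun j => ρ (e j)) atTop atTop := by
    refine tendsto_atTop_atTop_of_monotone he fun b => ?_
    by_contra! h
    have : (Set.univ : Set ℕ).Finite :=
      ((hfin b).preimage e.injective.injOn).subset fun j _ => (h j).le
    exact Set.infinite_univ this
  refine ⟨htop, ?_⟩
  have hcn : ∀ t, Nat.card {a | ρ a ≤ t} = {j | ρ (e j) ≤ t}.ncard := fun t => by
    rw [← Nat.card_coe_set_eq]
    exact Nat.card_congr (e.symm.subtypeEquiv fun a => by simp)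
  have hfin' : ∀ t, {j | ρ (e j) ≤ t}.Finite := fun t => (hfin t).preimage e.injective.injOn
  have hup : ∀ j : ℕ, j ≤ Nat.card {a | ρ a ≤ ρ (e j)} := fun j => by
    rw [hcn]
    calc j = (Set.Iio j).ncard := by simp [Set.ncard_eq_toFinset_card']
      _ ≤ _ := Set.ncard_le_ncard (fun i (hi : i < j) => he hi.le) (hfin' _)
  have hlow : ∀ j : ℕ, Nat.card {a | ρ a ≤ ρ (e j) - 1} ≤ j := fun j => by
    rw [hcn]
    calc _ ≤ (Set.Iio j).ncard := by
          refine Set.ncard_le_ncard (fun i hi => ?_) (Set.finite_Iio j)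
          by_contra h
          rw [Set.mem_ofPred] at hi
          have : ρ (e j) ≤ ρ (e i) := he (not_lt.1 h)
          linarith
      _ = j := by simp [Set.ncard_eq_toFinset_card']
  have h1 : Tendsto (fun j => (Nat.card {a | ρ a ≤ ρ (e j)} : ℝ) / ρ (e j) ^ d) atTop (nhds V) :=
    hcard.comp htop
  have hq : Tendsto (fun j => ((ρ (e j) - 1) / ρ (e j)) ^ d) atTop (nhds 1) := by
    have : Tendsto (fun j => 1 - (ρ (e j))⁻¹) atTop (nhds (1 - 0)) :=
      (tendsto_inv_atTop_zero.comp htop).const_sub 1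
    have := this.pow d
    rw [sub_zero, one_pow] at this
    refine this.congr' ?_
    filter_upwards [htop.eventually_gt_atTop 0] with j hj
    rw [sub_div, div_self hj.ne', one_div]
  have h2 : Tendsto (fun j => (Nat.card {a | ρ a ≤ ρ (e j) - 1} : ℝ) / ρ (e j) ^ d) atTop
      (nhds V) := by
    have := (hcard.comp (tendsto_atTop_add_const_right atTop (-1) htop)).mul hq
    rw [mul_one] at this
    refine this.congr' ?_
    filter_upwards [htop.eventually_gt_atTop 1] with j hj
    have a1 : ρ (e j) ^ d ≠ 0 := pow_ne_zero _ (by linarith)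
    have a2 : (ρ (e j) - 1) ^ d ≠ 0 := pow_ne_zero _ (by linarith)
    simp only [Function.comp_apply, ← sub_eq_add_neg]
    rw [div_pow]
    field_simp
  refine tendsto_of_tendsto_of_tendsto_of_le_of_le' h2 h1 ?_ ?_
  · filter_upwards [htop.eventually_gt_atTop 0] with j hj
    have := hlow j
    gcongr
  · filter_upwards [htop.eventually_gt_atTop 0] with j hj
    have := hup j
    gcongr

theorem wIso_pos (d : ℕ) (s r : ℝ) (k : ZLat d) : 0 < wIso d s r k := by
  unfold wIso
  positivity

/-- The weights `w_{s,r}` can be arranged in nondecreasing order `w_0 ≤ w_1 ≤ …`, and then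
`w_j^{-2} ∼ (vol(B_r^d) / j)^{2s/d}`. -/
theorem exists_rearrangement_wIso {d : ℕ} (hd : 0 < d) {s r : ℝ} (hs : 0 < s) (hr : 0 < r) :
    ∃ e : ℕ ≃ ZLat d, Monotone (fun j => wIso d s r (e j)) ∧
      Tendsto (fun j : ℕ => (j : ℝ) ^ (2 * s / d) * ((wIso d s r (e j))⁻¹) ^ 2) atTop
        (nhds ((volume {x : Fin d → ℝ | ∑ j, |x j| ^ r ≤ 1}).toReal ^ (2 * s / d))) := by
  have : Nonempty (Fin d) := ⟨⟨0, hd⟩⟩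
  have hd' : (0 : ℝ) < d := by exact_mod_cast hd
  set ρ : ZLat d → ℝ := fun k => (∑ j, |(k j : ℝ)| ^ r) ^ r⁻¹ with hρ
  have hρ0 : ∀ k, 0 ≤ ρ k := fun k => by positivity
  have hw : ∀ k, wIso d s r k = (1 + ρ k ^ r) ^ (s / r) := fun k => by
    rw [hρ, wIso, Real.rpow_inv_rpow (by positivity) hr.ne']
  obtain ⟨e, he⟩ := exists_equiv_nat_monotone ρ (finite_setOf_sum_rpow_le d hr)
  obtain ⟨htop, hlim⟩ := tendsto_div_pow_of_tendsto_card (finite_setOf_sum_rpow_le d hr)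
    (tendsto_card_lattice_div_pow d hr) e he
  refine ⟨e, fun i j hij => ?_, ?_⟩
  · simp only [hw]
    have := Real.rpow_le_rpow (hρ0 _) (he hij) hr.le
    have h0 := Real.rpow_nonneg (hρ0 (e i)) r
    exact Real.rpow_le_rpow (by positivity) (by linarith) (by positivity)
  · have h1 : Tendsto (fun j => ρ (e j) ^ r / (1 + ρ (e j) ^ r)) atTop (nhds 1) := by
      have ht : Tendsto (fun j => 1 + ρ (e j) ^ r) atTop atTop :=
        tendsto_atTop_add_const_left _ _ ((tendsto_rpow_atTop hr).comp htop)
      have := (tendsto_inv_atTop_zero.comp ht).const_sub 1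
      rw [sub_zero] at this
      refine this.congr fun j => ?_
      have h0 := Real.rpow_nonneg (hρ0 (e j)) r
      rw [Function.comp_apply]
      field_simp
      ring
    have h2 := (hlim.rpow_const (p := 2 * s / d) (Or.inr (by positivity))).mul
      (h1.rpow_const (p := 2 * s / r) (Or.inl one_ne_zero))
    rw [Real.one_rpow, mul_one] at h2
    refine h2.congr' ?_
    filter_upwards [htop.eventually_gt_atTop 0] with j hj
    have hj' : 0 < ρ (e j) := hj
    change ((j : ℝ) / ρ (e j) ^ d) ^ (2 * s / d) *
      (ρ (e j) ^ r / (1 + ρ (e j) ^ r)) ^ (2 * s / r) = _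
    have h0 := Real.rpow_nonneg hj'.le r
    rw [hw, Real.div_rpow (by positivity) (by positivity), Real.div_rpow h0 (by positivity),
      ← Real.rpow_natCast (ρ (e j)) d, ← Real.rpow_mul hj'.le, ← Real.rpow_mul hj'.le,
      mul_div_cancel₀ _ hd'.ne', mul_div_cancel₀ _ hr.ne',
      show (1 + ρ (e j) ^ r) ^ (2 * s / r) = ((1 + ρ (e j) ^ r) ^ (s / r)) ^ 2 by
        rw [← Real.rpow_mul_natCast (by positivity)]
        congr 1
        push_cast
        ring]
    have : ρ (e j) ^ (2 * s) ≠ 0 := (Real.rpow_pos_of_pos hj' _).ne'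
    field_simp

section Torus

variable {d : ℕ}

theorem torusMeasure_eq_pi (d : ℕ) :
    torusMeasure d = Measure.pi fun _ => (AddCircle.haarAddCircle : Measure (AddCircle _)) := by
  symm
  refine Measure.pi_eq fun s _ => ?_
  have h0 : ENNReal.ofReal (2 * Real.pi) ≠ 0 := by simp [Real.pi_pos]
  rw [torusMeasure, Measure.smul_apply, Measure.pi_pi]
  simp only [AddCircle.volume_eq_smul_haarAddCircle, Measure.smul_apply, smul_eq_mul,
    Finset.prod_mul_distrib, Finset.prod_const, Finset.card_univ, Fintype.card_fin]
  rw [← mul_assoc, ← mul_pow, ENNReal.inv_mul_cancel h0 ENNReal.ofReal_ne_top, one_pow, one_mul]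

instance isProbabilityMeasure_torusMeasure (d : ℕ) : IsProbabilityMeasure (torusMeasure d) := by
  rw [torusMeasure_eq_pi]
  infer_instance

instance isOpenPosMeasure_torusMeasure (d : ℕ) : (torusMeasure d).IsOpenPosMeasure := by
  rw [torusMeasure_eq_pi]
  infer_instance

/-- The character `e^{i k·x}` as a continuous function on the torus. -/
def torusCharC (k : ZLat d) : C(Torus d, ℂ) where
  toFun := torusChar k
  continuous_toFun := by
    unfold torusChar
    fun_prop

theorem torusCharC_apply (k : ZLat d) (x : Torus d) : torusCharC k x = torusChar k x := rfl

theorem torusChar_neg (k : ZLat d) (x : Torus d) :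
    torusChar (-k) x = (starRingEnd ℂ) (torusChar k x) := by
  simp only [torusChar, Pi.neg_apply, fourier_neg, map_prod]

theorem torusChar_add (k l : ZLat d) (x : Torus d) :
    torusChar (k + l) x = torusChar k x * torusChar l x := by
  simp only [torusChar, Pi.add_apply, fourier_add, ← Finset.prod_mul_distrib]

theorem torusChar_zero (x : Torus d) : torusChar (0 : ZLat d) x = 1 := by
  simp only [torusChar, Pi.zero_apply, fourier_zero, Finset.prod_const_one]

theorem norm_torusChar (k : ZLat d) (x : Torus d) : ‖torusChar k x‖ = 1 := by
  simp only [torusChar, fourier_apply, norm_prod, Circle.norm_coe, Finset.prod_const_one]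

theorem norm_torusCharC_le (k : ZLat d) : ‖torusCharC k‖ ≤ 1 :=
  (ContinuousMap.norm_le _ zero_le_one).2 fun x => (norm_torusChar k x).le

theorem integral_torusChar (k : ZLat d) :
    ∫ x, torusChar k x ∂torusMeasure d = if k = 0 then 1 else 0 := by
  split_ifs with h
  · simp [h, torusChar_zero]
  · obtain ⟨i, hi⟩ := Function.ne_iff.1 h
    rw [torusMeasure_eq_pi]
    simp only [torusChar]
    rw [integral_fintype_prod_eq_prod (𝕜 := ℂ) (fun i (y : AddCircle (2 * Real.pi)) =>
      fourier (k i) y)]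
    refine Finset.prod_eq_zero (Finset.mem_univ i) ?_
    have := (orthonormal_iff_ite.1 (orthonormal_fourier (T := 2 * Real.pi))) 0 (k i)
    rw [if_neg fun h' => hi h'.symm, ContinuousMap.inner_toLp] at this
    simpa using this

/-- The characters as elements of `L²`. -/
def torusCharL2 (k : ZLat d) : Lp ℂ 2 (torusMeasure d) :=
  ContinuousMap.toLp 2 (torusMeasure d) ℂ (torusCharC k)

theorem orthonormal_torusCharL2 : Orthonormal ℂ (torusCharL2 (d := d)) := by
  classical
  rw [orthonormal_iff_ite]
  intro k l
  simp only [torusCharL2, ContinuousMap.inner_toLp, torusCharC_apply, ← torusChar_neg,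
    ← torusChar_add, integral_torusChar]
  congr 1
  exact propext (add_neg_eq_zero.trans eq_comm)

theorem span_torusCharC_closure_eq_top :
    (Submodule.span ℂ (Set.range (torusCharC (d := d)))).topologicalClosure = ⊤ := by
  classical
  let S : StarSubalgebra ℂ C(Torus d, ℂ) :=
    { toSubalgebra := Algebra.adjoin ℂ (Set.range torusCharC)
      star_mem' := by
        change Algebra.adjoin ℂ (Set.range torusCharC) ≤
          star (Algebra.adjoin ℂ (Set.range torusCharC))
        refine Algebra.adjoin_le ?_
        rintro _ ⟨n, rfl⟩
        refine Algebra.subset_adjoin ⟨-n, ?_⟩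
        ext1 x
        simp only [torusCharC_apply, torusChar_neg, starRingEnd_apply, ContinuousMap.star_apply] }
  have hS : S.toSubalgebra.toSubmodule = Submodule.span ℂ (Set.range torusCharC) := by
    apply Algebra.adjoin_eq_span_of_subset
    refine .trans (fun x => Submonoid.closure_induction (fun _ => id) ⟨0, ?_⟩ ?_)
      Submodule.subset_span
    · ext z
      simp [torusCharC_apply, torusChar_zero]
    · rintro _ _ _ _ ⟨m, rfl⟩ ⟨n, rfl⟩
      refine ⟨m + n, ?_⟩
      ext z
      simp [torusCharC_apply, torusChar_add]
  have hsep : S.SeparatesPoints := by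
    intro x y hxy
    obtain ⟨i, hi⟩ := Function.ne_iff.1 hxy
    refine ⟨_, ⟨torusCharC (Pi.single i 1), Algebra.subset_adjoin ⟨Pi.single i 1, rfl⟩, rfl⟩, ?_⟩
    have hone : ∀ z : Torus d, torusChar (Pi.single i 1) z = fourier 1 (z i) := fun z => by
      rw [torusChar, Finset.prod_eq_single i]
      · rw [Pi.single_eq_same]
      · intro j _ hj
        rw [Pi.single_eq_of_ne hj, fourier_zero]
      · simp
    change torusChar _ x ≠ torusChar _ y
    rw [hone, hone, fourier_one, fourier_one]
    exact fun h => hi (AddCircle.injective_toCircle (by positivity) (Circle.ext h))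
  rw [← hS]
  exact congr_arg (Subalgebra.toSubmodule <| StarSubalgebra.toSubalgebra ·)
    (ContinuousMap.starSubalgebra_topologicalClosure_eq_top_of_separatesPoints S hsep)

theorem span_torusCharL2_closure_eq_top :
    (Submodule.span ℂ (Set.range (torusCharL2 (d := d)))).topologicalClosure = ⊤ := by
  simpa only [Submodule.map_span, ContinuousLinearMap.coe_coe, ← Set.range_comp,
    Function.comp_def] using!
      (ContinuousMap.toLp_denseRange ℂ (torusMeasure d) ℂ
        (p := 2) (by simp)).topologicalClosure_map_submodule span_torusCharC_closure_eq_top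

theorem fourierCoef_congr_ae {f g : Torus d → ℂ} (h : f =ᵐ[torusMeasure d] g) (k : ZLat d) :
    fourierCoef f k = fourierCoef g k :=
  integral_congr_ae (h.mono fun x hx => by simp only [hx])

theorem fourierCoef_eq_inner (f : Lp ℂ 2 (torusMeasure d)) (k : ZLat d) :
    fourierCoef f k = inner ℂ (torusCharL2 k) f := by
  rw [L2.inner_def, fourierCoef]
  refine integral_congr_ae ?_
  filter_upwards [ContinuousMap.coeFn_toLp (p := 2) (𝕜 := ℂ) (torusMeasure d) (torusCharC k)]
    with x hx
  rw [torusCharL2, hx, RCLike.inner_apply', torusCharC_apply]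

/-- An `L²` function on the torus is determined by its Fourier coefficients. -/
theorem Lp_two_ext_fourierCoef {f g : Lp ℂ 2 (torusMeasure d)}
    (h : ∀ k, fourierCoef f k = fourierCoef g k) : f = g := by
  let b := HilbertBasis.mk orthonormal_torusCharL2 (span_torusCharL2_closure_eq_top (d := d)).ge
  refine b.repr.injective (lp.ext (funext fun k => ?_))
  rw [b.repr_apply_apply, b.repr_apply_apply, HilbertBasis.coe_mk, ← fourierCoef_eq_inner,
    ← fourierCoef_eq_inner, h]

theorem memLp_two_of_memLp_top (f : Lp ℂ ⊤ (torusMeasure d)) : MemLp f 2 (torusMeasure d) :=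
  (Lp.memLp f).mono_exponent le_top

/-- An `L^∞` function on the torus is determined by its Fourier coefficients. -/
theorem Lp_top_ext_fourierCoef {f g : Lp ℂ ⊤ (torusMeasure d)}
    (h : ∀ k, fourierCoef f k = fourierCoef g k) : f = g := by
  have hf := memLp_two_of_memLp_top f
  have hg := memLp_two_of_memLp_top g
  have : hf.toLp f = hg.toLp g := Lp_two_ext_fourierCoef fun k => by
    rw [fourierCoef_congr_ae hf.coeFn_toLp, fourierCoef_congr_ae hg.coeFn_toLp, h]
  exact Lp.ext ((MemLp.toLp_eq_toLp_iff hf hg).1 this)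

theorem fourierCoef_toLp (p : ℝ≥0∞) [Fact (1 ≤ p)] (f : C(Torus d, ℂ)) (k : ZLat d) :
    fourierCoef (ContinuousMap.toLp p (torusMeasure d) ℂ f) k = fourierCoef f k :=
  fourierCoef_congr_ae (ContinuousMap.coeFn_toLp _ _) k

/-- A continuous function on the torus is determined by its Fourier coefficients. -/
theorem continuousMap_ext_fourierCoef {f g : C(Torus d, ℂ)}
    (h : ∀ k, fourierCoef f k = fourierCoef g k) : f = g := by
  refine ContinuousMap.toLp_injective (p := 2) (𝕜 := ℂ) (torusMeasure d) ?_
  exact Lp_two_ext_fourierCoef fun k => by rw [fourierCoef_toLp, fourierCoef_toLp, h]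

/-- Bessel's inequality for bounded functions on the torus. -/
theorem sum_norm_sq_fourierCoef_le (f : Lp ℂ ⊤ (torusMeasure d)) (F : Finset (ZLat d)) :
    ∑ k ∈ F, ‖fourierCoef f k‖ ^ 2 ≤ ∫ x, ‖f x‖ ^ 2 ∂torusMeasure d := by
  have hf := memLp_two_of_memLp_top f
  have h := orthonormal_torusCharL2.sum_inner_products_le (hf.toLp f) (s := F)
  simp only [← fourierCoef_eq_inner, fourierCoef_congr_ae hf.coeFn_toLp] at h
  refine h.trans_eq ?_
  rw [← inner_self_eq_norm_sq (𝕜 := ℂ), L2.inner_def, ← integral_re (L2.integrable_inner _ _)]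
  refine integral_congr_ae ?_
  filter_upwards [hf.coeFn_toLp] with x hx
  rw [hx, inner_self_eq_norm_sq]

theorem summable_norm_ellOne (a : ellOne d) : Summable fun k => ‖a k‖ := by
  simpa using (lp.hasSum_norm (by simp) a).summable

theorem norm_ellOne (a : ellOne d) : ‖a‖ = ∑' k, ‖a k‖ := by
  simpa using lp.norm_rpow_eq_tsum (by simp) a

theorem summable_smul_torusCharC (a : ellOne d) : Summable fun k => a k • torusCharC k :=
  (summable_norm_ellOne a).of_norm_bounded fun k => by
    rw [norm_smul]
    exact mul_le_of_le_one_right (norm_nonneg _) (norm_torusCharC_le k)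

/-- Summation of an absolutely convergent Fourier series, as an operator `ℓ¹ → C(𝕋^d)`. -/
def fourierSynthesis (d : ℕ) : ellOne d →L[ℂ] C(Torus d, ℂ) :=
  LinearMap.mkContinuous
    { toFun := fun a => ∑' k, a k • torusCharC k
      map_add' := fun a b => by
        rw [← (summable_smul_torusCharC a).tsum_add (summable_smul_torusCharC b)]
        simp only [lp.coeFn_add, Pi.add_apply, add_smul]
      map_smul' := fun c a => by
        rw [RingHom.id_apply, ← (summable_smul_torusCharC a).tsum_const_smul]
        simp only [lp.coeFn_smul, Pi.smul_apply, smul_assoc] }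
    1 fun a => by
      rw [one_mul, norm_ellOne]
      refine tsum_of_norm_bounded (summable_norm_ellOne a).hasSum fun k => ?_
      rw [norm_smul]
      exact mul_le_of_le_one_right (norm_nonneg _) (norm_torusCharC_le k)

theorem norm_fourierSynthesis_le (d : ℕ) : ‖fourierSynthesis d‖ ≤ 1 :=
  LinearMap.mkContinuous_norm_le _ zero_le_one _

theorem fourierCoef_fourierSynthesis (a : ellOne d) (k : ZLat d) :
    fourierCoef (fourierSynthesis d a) k = a k := by
  classical
  let φ : C(Torus d, ℂ) →L[ℂ] ℂ :=
    (innerSL ℂ (torusCharL2 k)).comp (ContinuousMap.toLp 2 (torusMeasure d) ℂ)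
  have hφ : ∀ f : C(Torus d, ℂ), fourierCoef f k = φ f := fun f => by
    rw [← fourierCoef_toLp 2, fourierCoef_eq_inner]
    rfl
  have hχ : ∀ l, φ (torusCharC l) = if k = l then 1 else 0 := fun l =>
    orthonormal_iff_ite.1 orthonormal_torusCharL2 k l
  have h := φ.hasSum (summable_smul_torusCharC a).hasSum
  rw [hφ]
  refine h.unique ?_
  simp only [map_smul, hχ, smul_eq_mul, mul_ite, mul_one, mul_zero]
  have := hasSum_ite_eq k (a k)
  refine this.congr_fun fun l => ?_
  by_cases hl : l = k
  · subst hl; simp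
  · simp [hl, Ne.symm hl]

end Torus

section ApproxNum

variable {X Y : Type*} [NormedAddCommGroup X] [NormedSpace ℂ X] [NormedAddCommGroup Y]
  [NormedSpace ℂ Y]

theorem approxNum_le (T A : X →L[ℂ] Y) {n : ℕ}
    (hA : Module.rank ℂ (LinearMap.range (A : X →ₗ[ℂ] Y)) < n) : approxNum T n ≤ ‖T - A‖ :=
  csInf_le ⟨0, by rintro _ ⟨B, _, rfl⟩; exact norm_nonneg _⟩ ⟨A, hA, rfl⟩

theorem le_approxNum_succ (T : X →L[ℂ] Y) {n : ℕ} {b : ℝ}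
    (h : ∀ A : X →L[ℂ] Y, Module.rank ℂ (LinearMap.range (A : X →ₗ[ℂ] Y)) < (n + 1 : ℕ) →
      b ≤ ‖T - A‖) : b ≤ approxNum T (n + 1) := by
  refine le_csInf ⟨_, 0, ?_, rfl⟩ ?_
  · rw [ContinuousLinearMap.toLinearMap_zero, LinearMap.range_zero, rank_bot]
    exact_mod_cast n.succ_pos
  · rintro _ ⟨A, hA, rfl⟩
    exact h A hA

end ApproxNum

/-- Composition with a contraction does not increase approximation numbers. -/
theorem approxNum_comp_le {X Y Z : Type} [NormedAddCommGroup X] [NormedSpace ℂ X]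
    [NormedAddCommGroup Y] [NormedSpace ℂ Y] [NormedAddCommGroup Z] [NormedSpace ℂ Z]
    (Φ : Y →L[ℂ] Z) (hΦ : ‖Φ‖ ≤ 1) (T : X →L[ℂ] Y) (n : ℕ) :
    approxNum (Φ.comp T) (n + 1) ≤ approxNum T (n + 1) := by
  refine le_approxNum_succ T fun A hA => ?_
  refine (approxNum_le (Φ.comp T) (Φ.comp A) ?_).trans ?_
  · exact (LinearMap.rank_comp_le_right (A : X →ₗ[ℂ] Y) (Φ : Y →ₗ[ℂ] Z)).trans_lt hA
  · rw [← ContinuousLinearMap.comp_sub]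
    exact (Φ.opNorm_comp_le _).trans (mul_le_of_le_one_left (norm_nonneg _) hΦ)

section Diagonal

variable {d : ℕ}

theorem summable_norm_sq_ellTwo (c : ellTwo d) : Summable fun k => ‖c k‖ ^ 2 := by
  simpa using (lp.hasSum_norm (by simp) c).summable

theorem tsum_norm_sq_ellTwo (c : ellTwo d) : ∑' k, ‖c k‖ ^ 2 = ‖c‖ ^ 2 := by
  simpa using (lp.norm_rpow_eq_tsum (by simp) c).symm

theorem summable_mul_norm_ellTwo {τ : ZLat d → ℝ} (hτ : ∀ k, 0 ≤ τ k)
    (hs : Summable fun k => τ k ^ 2) (c : ellTwo d) : Summable fun k => τ k * ‖c k‖ :=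
  Real.summable_mul_of_Lp_Lq_of_nonneg (p := 2) (q := 2) Real.HolderConjugate.two_two hτ
    (fun _ => norm_nonneg _) (by simpa using hs) (by simpa using summable_norm_sq_ellTwo c)

theorem tsum_mul_norm_ellTwo_le {τ : ZLat d → ℝ} (hτ : ∀ k, 0 ≤ τ k)
    (hs : Summable fun k => τ k ^ 2) (c : ellTwo d) :
    ∑' k, τ k * ‖c k‖ ≤ Real.sqrt (∑' k, τ k ^ 2) * ‖c‖ := by
  have h := Real.inner_le_Lp_mul_Lq_tsum_of_nonneg (p := 2) (q := 2)
    Real.HolderConjugate.two_two hτ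
    (fun k => norm_nonneg (c k)) (by simpa using hs) (by simpa using summable_norm_sq_ellTwo c)
  simpa only [Real.rpow_two, ← Real.sqrt_eq_rpow, tsum_norm_sq_ellTwo,
    Real.sqrt_sq (norm_nonneg c)] using h

/-- A diagonal operator with square summable entries, from `ℓ²` to `ℓ¹`. -/
def diagonalOp {d : ℕ} (τ : ZLat d → ℝ) (hτ : ∀ k, 0 ≤ τ k) (hs : Summable fun k => τ k ^ 2) :
    ellTwo d →L[ℂ] ellOne d :=
  LinearMap.mkContinuous
    { toFun := fun c => ⟨fun k => τ k * c k, memℓp_gen (by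
        simpa [abs_of_nonneg (hτ _)] using summable_mul_norm_ellTwo hτ hs c)⟩
      map_add' := fun a b => lp.ext (funext fun k => mul_add _ _ _)
      map_smul' := fun z a => lp.ext (funext fun k => mul_left_comm _ _ _) }
    (Real.sqrt (∑' k, τ k ^ 2)) fun c => by
      rw [norm_ellOne]
      simpa [abs_of_nonneg (hτ _)] using tsum_mul_norm_ellTwo_le hτ hs c

theorem diagonalOp_apply (τ : ZLat d → ℝ) (hτ : ∀ k, 0 ≤ τ k) (hs : Summable fun k => τ k ^ 2)
    (c : ellTwo d) (k : ZLat d) : diagonalOp τ hτ hs c k = τ k * c k := rfl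

theorem norm_diagonalOp_le (τ : ZLat d → ℝ) (hτ : ∀ k, 0 ≤ τ k)
    (hs : Summable fun k => τ k ^ 2) : ‖diagonalOp τ hτ hs‖ ≤ Real.sqrt (∑' k, τ k ^ 2) :=
  LinearMap.mkContinuous_norm_le _ (Real.sqrt_nonneg _) _

theorem finite_rank_diagonalOp (τ : ZLat d → ℝ) (hτ : ∀ k, 0 ≤ τ k)
    (hs : Summable fun k => τ k ^ 2) (F : Finset (ZLat d)) (hF : ∀ k ∉ F, τ k = 0) :
    Module.rank ℂ (LinearMap.range (diagonalOp τ hτ hs : ellTwo d →ₗ[ℂ] ellOne d)) ≤ F.card := by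
  classical
  have hle : LinearMap.range (diagonalOp τ hτ hs : ellTwo d →ₗ[ℂ] ellOne d) ≤
      Submodule.span ℂ (F.image fun k => (lp.single 1 k (1 : ℂ) : ellOne d) : Finset _) := by
    rintro _ ⟨c, rfl⟩
    have : (diagonalOp τ hτ hs : ellTwo d →ₗ[ℂ] ellOne d) c =
        ∑ k ∈ F, (τ k * c k) • (lp.single 1 k (1 : ℂ) : ellOne d) := by
      refine lp.ext (funext fun l => ?_)
      rw [ContinuousLinearMap.coe_coe, diagonalOp_apply, lp.coeFn_sum, Finset.sum_apply]
      by_cases hl : l ∈ F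
      · rw [Finset.sum_eq_single l]
        · simp
        · intro k _ hk
          simp [lp.single_apply, hk.symm]
        · exact fun h => (h hl).elim
      · rw [hF l hl, Finset.sum_eq_zero]
        · simp
        · intro k hk
          have : l ≠ k := fun h => hl (h ▸ hk)
          simp [lp.single_apply, this]
    rw [this]
    refine Submodule.sum_mem _ fun k hk => Submodule.smul_mem _ _ (Submodule.subset_span ?_)
    exact Finset.mem_coe.2 (Finset.mem_image_of_mem _ hk)
  refine (Submodule.rank_mono hle).trans ((rank_span_finset_le _).trans ?_)
  exact_mod_cast Finset.card_image_le

/-- The approximation numbers of a diagonal operator `ℓ² → ℓ¹` are bounded by the `ℓ²` norms of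
the tails of its diagonal. -/
theorem approxNum_diagonalOp_le (τ : ZLat d → ℝ) (hτ : ∀ k, 0 ≤ τ k)
    (hs : Summable fun k => τ k ^ 2) (e : ℕ ≃ ZLat d) (n : ℕ) :
    approxNum (diagonalOp τ hτ hs) (n + 1) ≤ Real.sqrt (∑' j, τ (e (j + n)) ^ 2) := by
  classical
  let F : Finset (ZLat d) := (Finset.range n).map e.toEmbedding
  let τ₁ : ZLat d → ℝ := fun k => if k ∈ F then τ k else 0
  let τ₂ : ZLat d → ℝ := fun k => if k ∈ F then 0 else τ k
  have h₁ : ∀ k, 0 ≤ τ₁ k := fun k => by simp only [τ₁]; split_ifs <;> simp [hτ]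
  have h₂ : ∀ k, 0 ≤ τ₂ k := fun k => by simp only [τ₂]; split_ifs <;> simp [hτ]
  have hs₁ : Summable fun k => τ₁ k ^ 2 := hs.of_nonneg_of_le (fun _ => sq_nonneg _) fun k => by
    simp only [τ₁]; split_ifs <;> simp [sq_nonneg]
  have hs₂ : Summable fun k => τ₂ k ^ 2 := hs.of_nonneg_of_le (fun _ => sq_nonneg _) fun k => by
    simp only [τ₂]; split_ifs <;> simp [sq_nonneg]
  have hrank := finite_rank_diagonalOp τ₁ h₁ hs₁ F fun k hk => by simp only [τ₁, if_neg hk]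
  have hsub : diagonalOp τ hτ hs - diagonalOp τ₁ h₁ hs₁ = diagonalOp τ₂ h₂ hs₂ := by
    refine ContinuousLinearMap.ext fun c => lp.ext (funext fun k => ?_)
    rw [sub_apply, lp.coeFn_sub, Pi.sub_apply]
    simp only [diagonalOp_apply, τ₁, τ₂]
    split_ifs <;> simp
  have htail : ∑' k, τ₂ k ^ 2 = ∑' j, τ (e (j + n)) ^ 2 := by
    have hs₃ : Summable fun j => τ₂ (e j) ^ 2 := (e.summable_iff (f := fun k => τ₂ k ^ 2)).2 hs₂
    rw [← e.tsum_eq, ← hs₃.sum_add_tsum_nat_add n, Finset.sum_eq_zero, zero_add]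
    · refine tsum_congr fun j => ?_
      simp [τ₂, F]
    · intro j hj
      have := Finset.mem_range.1 hj
      simp [τ₂, F, this]
  refine (approxNum_le _ (diagonalOp τ₁ h₁ hs₁) (hrank.trans_lt ?_)).trans ?_
  · simp only [F, Finset.card_map, Finset.card_range]
    exact_mod_cast n.lt_succ_self
  · rw [hsub, ← htail]
    exact norm_diagonalOp_le τ₂ h₂ hs₂

end Diagonal

section LowerBound

variable {d : ℕ} {H : Type*} [NormedAddCommGroup H] [InnerProductSpace ℂ H]

theorem Lp_coeFn_sum_smul {ι : Type*} {p : ℝ≥0∞} {α : Type*} [MeasurableSpace α] {μ : Measure α}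
    (F : Finset ι) (a : ι → ℂ) (f : ι → Lp ℂ p μ) :
    ⇑(∑ i ∈ F, a i • f i) =ᵐ[μ] fun x => ∑ i ∈ F, a i * f i x := by
  classical
  induction F using Finset.induction_on with
  | empty =>
    simp only [Finset.sum_empty]
    exact Lp.coeFn_zero _ _ _
  | insert i F hi ih =>
    rw [Finset.sum_insert hi]
    filter_upwards [ih, Lp.coeFn_add (a i • f i) (∑ i ∈ F, a i • f i),
      Lp.coeFn_smul (a i) (f i)] with x h1 h2 h3
    rw [h2, Pi.add_apply, h1, h3, Pi.smul_apply, smul_eq_mul, Finset.sum_insert hi]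

theorem ae_norm_le_norm_Lp_top {α : Type*} [MeasurableSpace α] {μ : Measure α} (f : Lp ℂ ⊤ μ) :
    ∀ᵐ x ∂μ, ‖f x‖ ≤ ‖f‖ := by
  filter_upwards [ae_le_eLpNormEssSup (f := f) (μ := μ)] with x hx
  rw [Lp.norm_def, ← toReal_enorm]
  refine ENNReal.toReal_mono (Lp.eLpNorm_ne_top f) ?_
  rwa [eLpNorm_exponent_top]

/-- For an operator `S` into `L^∞` and an orthonormal system `u`, the square function of `S u` is
bounded by the norm of `S` almost everywhere. -/
theorem ae_sum_norm_sq_le {α : Type*} [MeasurableSpace α] {μ : Measure α} {m : ℕ}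
    (S : H →L[ℂ] Lp ℂ ⊤ μ) {u : Fin m → H} (hu : Orthonormal ℂ u) :
    ∀ᵐ x ∂μ, ∑ i, ‖S (u i) x‖ ^ 2 ≤ ‖S‖ ^ 2 := by
  have hfix : ∀ a : Fin m → ℂ,
      ∀ᵐ x ∂μ, ‖∑ i, a i * S (u i) x‖ ^ 2 ≤ ‖S‖ ^ 2 * ∑ i, ‖a i‖ ^ 2 := fun a => by
    have hnorm : ‖∑ i, a i • u i‖ ^ 2 = ∑ i, ‖a i‖ ^ 2 := by
      rw [← inner_self_eq_norm_sq (𝕜 := ℂ), hu.inner_sum, map_sum]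
      refine Finset.sum_congr rfl fun i _ => ?_
      rw [RCLike.conj_mul, ← RCLike.ofReal_pow, RCLike.ofReal_re]
    have hS : S (∑ i, a i • u i) = ∑ i, a i • S (u i) := by simp
    filter_upwards [ae_norm_le_norm_Lp_top (S (∑ i, a i • u i)),
      Lp_coeFn_sum_smul Finset.univ a fun i => S (u i)] with x h1 h2
    rw [hS] at h1
    rw [h2, ← hS] at h1
    rw [← hnorm, ← mul_pow]
    exact pow_le_pow_left₀ (norm_nonneg _) (h1.trans (S.le_opNorm _)) 2
  have hdense := ae_all_iff.2 fun j => hfix (TopologicalSpace.denseSeq (Fin m → ℂ) j)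
  filter_upwards [hdense] with x hx
  have hall : ∀ a : Fin m → ℂ, ‖∑ i, a i * S (u i) x‖ ^ 2 ≤ ‖S‖ ^ 2 * ∑ i, ‖a i‖ ^ 2 := by
    intro a
    refine (TopologicalSpace.denseRange_denseSeq (Fin m → ℂ)).induction_on
      (p := fun a => ‖∑ i, a i * S (u i) x‖ ^ 2 ≤ ‖S‖ ^ 2 * ∑ i, ‖a i‖ ^ 2) a ?_ hx
    exact isClosed_le (by fun_prop) (by fun_prop)
  have h := hall fun i => (starRingEnd ℂ) (S (u i) x)
  simp only [RCLike.conj_mul, RCLike.norm_conj] at h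
  have hnn : 0 ≤ ∑ i, ‖S (u i) x‖ ^ 2 := by positivity
  have e : ‖∑ i, ((‖S (u i) x‖ : ℂ)) ^ 2‖ = ∑ i, ‖S (u i) x‖ ^ 2 := by
    have : ∑ i, ((‖S (u i) x‖ : ℂ)) ^ 2 = ((∑ i, ‖S (u i) x‖ ^ 2 : ℝ) : ℂ) := by push_cast; rfl
    rw [this, Complex.norm_real, Real.norm_of_nonneg hnn]
  erw [e] at h
  rcases hnn.eq_or_lt with h0 | h0
  · rw [← h0]; positivity
  · rw [pow_two (∑ i, _)] at h
    exact le_of_mul_le_mul_right h h0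

/-- An operator from a Hilbert space to `L^∞` of the torus is bounded below by its Fourier
coefficients on an orthonormal system. -/
theorem sum_sum_norm_sq_fourierCoef_le {m : ℕ} (S : H →L[ℂ] Lp ℂ ⊤ (torusMeasure d))
    {u : Fin m → H} (hu : Orthonormal ℂ u) (F : Finset (ZLat d)) :
    ∑ i, ∑ k ∈ F, ‖fourierCoef (S (u i)) k‖ ^ 2 ≤ ‖S‖ ^ 2 := by
  have hint : ∀ i, Integrable (fun x => ‖S (u i) x‖ ^ 2) (torusMeasure d) := fun i =>
    (memLp_two_of_memLp_top (S (u i))).norm.integrable_sq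
  calc ∑ i, ∑ k ∈ F, ‖fourierCoef (S (u i)) k‖ ^ 2
      ≤ ∑ i, ∫ x, ‖S (u i) x‖ ^ 2 ∂torusMeasure d :=
        Finset.sum_le_sum fun i _ => sum_norm_sq_fourierCoef_le _ F
    _ = ∫ x, ∑ i, ‖S (u i) x‖ ^ 2 ∂torusMeasure d :=
        (integral_finsetSum _ fun i _ => hint i).symm
    _ ≤ ∫ _, ‖S‖ ^ 2 ∂torusMeasure d :=
        integral_mono_ae (integrable_finsetSum _ fun i _ => hint i) (integrable_const _)
          (ae_sum_norm_sq_le S hu)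
    _ = ‖S‖ ^ 2 := by simp

/-- The minimum of a weighted sum with antitone weights and coefficients in `[0, 1]`. -/
theorem sum_le_sum_mul_of_antitone {f q : ℕ → ℝ} (hf : Antitone f) (hf0 : ∀ j, 0 ≤ f j)
    (hq0 : ∀ j, 0 ≤ q j) (hq1 : ∀ j, q j ≤ 1) {n m : ℕ}
    (hq : (m : ℝ) ≤ ∑ j ∈ Finset.range (n + m), q j) :
    ∑ j ∈ Finset.range m, f (n + j) ≤ ∑ j ∈ Finset.range (n + m), f j * q j := by
  rw [Finset.sum_range_add] at hq ⊢
  have h1 : ∑ j ∈ Finset.range n, f n * q j ≤ ∑ j ∈ Finset.range n, f j * q j :=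
    Finset.sum_le_sum fun j hj =>
      mul_le_mul_of_nonneg_right (hf (Finset.mem_range.1 hj).le) (hq0 j)
  have h2 : ∑ j ∈ Finset.range m, (f (n + j) - f n * (1 - q (n + j))) ≤
      ∑ j ∈ Finset.range m, f (n + j) * q (n + j) :=
    Finset.sum_le_sum fun j _ => by
      have := mul_le_mul_of_nonneg_right (hf (Nat.le_add_right n j)) (sub_nonneg.2 (hq1 (n + j)))
      linarith
  rw [Finset.sum_sub_distrib, ← Finset.mul_sum, Finset.sum_sub_distrib] at h2
  rw [← Finset.mul_sum] at h1
  simp only [Finset.sum_const, Finset.card_range, nsmul_eq_mul, mul_one] at h2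
  have h3 := mul_le_mul_of_nonneg_left hq (hf0 n)
  linarith

end LowerBound

section LowerBoundDiagonal

variable {d : ℕ}

theorem orthonormal_single_comp (e : ℕ ≃ ZLat d) (M : ℕ) :
    Orthonormal ℂ fun j : Fin M => (lp.single 2 (e j) (1 : ℂ) : ellTwo d) := by
  classical
  rw [orthonormal_iff_ite]
  intro i j
  rw [lp.inner_single_left, lp.single_apply]
  by_cases h : i = j
  · subst h; simp
  · have : (e i : ZLat d) ≠ e j := fun h' => h (Fin.ext (e.injective h'))
    simp [h, this]

/-- The isometric embedding of `ℂ^M` into `ℓ²(ℤ^d)` along the first `M` indices. -/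
def coordinateEmbedding (e : ℕ ≃ ZLat d) (M : ℕ) : EuclideanSpace ℂ (Fin M) →ₗᵢ[ℂ] ellTwo d :=
  ((EuclideanSpace.basisFun (Fin M) ℂ).toBasis.constr ℂ fun j : Fin M =>
    (lp.single 2 (e j) (1 : ℂ) : ellTwo d)).isometryOfOrthonormal
    (v := (EuclideanSpace.basisFun (Fin M) ℂ).toBasis)
    (by simp)
    (by
      convert orthonormal_single_comp e M using 1
      funext j
      rw [Function.comp_apply, Module.Basis.constr_basis])

theorem coordinateEmbedding_apply (e : ℕ ≃ ZLat d) (M : ℕ) (y : EuclideanSpace ℂ (Fin M))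
    (j : Fin M) : coordinateEmbedding e M y (e j) = y j := by
  classical
  have h : coordinateEmbedding e M y = ∑ l, y l • (lp.single 2 (e l) (1 : ℂ) : ellTwo d) := by
    change (EuclideanSpace.basisFun (Fin M) ℂ).toBasis.constr ℂ _ y = _
    rw [Module.Basis.constr_apply_fintype]
    simp
  rw [h, lp.coeFn_sum, Finset.sum_apply, Finset.sum_eq_single j]
  · simp
  · intro l _ hl
    have : (e j : ZLat d) ≠ e l := fun h' => hl (Fin.ext (e.injective h')).symm
    simp [lp.single_apply, this]
  · simp

/-- Lower bound for the error of approximation of a diagonal operator from `ℓ²` into `L^∞` of the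
torus by operators of finite rank. -/
theorem sum_sq_le_norm_sub_sq {τ : ZLat d → ℝ} (hτ : ∀ k, 0 ≤ τ k) (e : ℕ ≃ ZLat d)
    (hanti : Antitone fun j => τ (e j)) {T : ellTwo d →L[ℂ] Lp ℂ ⊤ (torusMeasure d)}
    (hT : ∀ c k, fourierCoef (T c) k = τ k * c k) {n : ℕ}
    {A : ellTwo d →L[ℂ] Lp ℂ ⊤ (torusMeasure d)}
    (hA : Module.rank ℂ (LinearMap.range (A : ellTwo d →ₗ[ℂ] Lp ℂ ⊤ (torusMeasure d))) < (n + 1 : ℕ)) (m : ℕ) :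
    ∑ j ∈ Finset.range m, τ (e (n + j)) ^ 2 ≤ ‖T - A‖ ^ 2 := by
  classical
  set L := coordinateEmbedding e (n + m)
  let B : EuclideanSpace ℂ (Fin (n + m)) →ₗ[ℂ] Lp ℂ ⊤ (torusMeasure d) :=
    (A : ellTwo d →ₗ[ℂ] Lp ℂ ⊤ (torusMeasure d)) ∘ₗ L.toLinearMap
  have hB : Module.finrank ℂ (LinearMap.range B) < n + 1 :=
    Module.finrank_lt_of_rank_lt ((LinearMap.rank_comp_le_left _ _).trans_lt hA)
  have hN := LinearMap.finrank_range_add_finrank_ker B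
  rw [finrank_euclideanSpace_fin] at hN
  let b := stdOrthonormalBasis ℂ (LinearMap.ker B)
  let u : Fin (Module.finrank ℂ (LinearMap.ker B)) → ellTwo d := fun i => L (b i)
  have hu : Orthonormal ℂ u :=
    (b.orthonormal.comp_linearIsometry (LinearMap.ker B).subtypeₗᵢ).comp_linearIsometry L
  have hAu : ∀ i, A (u i) = 0 := fun i => LinearMap.mem_ker.1 (b i).2
  let q : ℕ → ℝ := fun j => ∑ i, ‖u i (e j)‖ ^ 2
  have hq1 : ∀ j, q j ≤ 1 := fun j => by
    have h := hu.sum_inner_products_le (lp.single 2 (e j) (1 : ℂ) : ellTwo d)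
      (s := Finset.univ)
    simpa [lp.inner_single_right, lp.norm_single] using h
  have hq : ∑ j ∈ Finset.range (n + m), q j = Module.finrank ℂ (LinearMap.ker B) := by
    rw [Finset.sum_range, Finset.sum_comm]
    have : ∀ i, ∑ j : Fin (n + m), ‖u i (e j)‖ ^ 2 = 1 := fun i => by
      have h1 : ‖(b i : EuclideanSpace ℂ (Fin (n + m)))‖ = 1 := b.orthonormal.1 i
      simp only [u, L, coordinateEmbedding_apply]
      rw [← EuclideanSpace.norm_sq_eq, h1, one_pow]
    simp [this]
  have key := sum_le_sum_mul_of_antitone (f := fun j => τ (e j) ^ 2) (q := q) (n := n) (m := m)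
    (fun i j hij => pow_le_pow_left₀ (hτ _) (hanti hij) 2) (fun j => sq_nonneg _)
    (fun j => by positivity) hq1 (by rw [hq]; exact_mod_cast (by omega))
  refine key.trans (le_of_eq_of_le ?_ (sum_sum_norm_sq_fourierCoef_le (T - A) hu
    ((Finset.range (n + m)).map e.toEmbedding)))
  simp only [sub_apply, hAu, sub_zero, hT, Finset.sum_map, q, Finset.mul_sum,
    norm_mul, mul_pow, Complex.norm_real, Real.norm_eq_abs, sq_abs]
  rw [Finset.sum_comm]
  rfl

theorem sqrt_tsum_le_approxNum {τ : ZLat d → ℝ} (hτ : ∀ k, 0 ≤ τ k) (e : ℕ ≃ ZLat d)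
    (hanti : Antitone fun j => τ (e j)) {T : ellTwo d →L[ℂ] Lp ℂ ⊤ (torusMeasure d)}
    (hT : ∀ c k, fourierCoef (T c) k = τ k * c k) (n : ℕ) :
    Real.sqrt (∑' j, τ (e (j + n)) ^ 2) ≤ approxNum T (n + 1) := by
  refine le_approxNum_succ T fun A hA => Real.sqrt_le_iff.2 ⟨norm_nonneg _, ?_⟩
  refine Real.tsum_le_of_sum_range_le (fun _ => sq_nonneg _) fun m => ?_
  simpa only [add_comm n] using sum_sq_le_norm_sub_sq hτ e hanti hT hA m

end LowerBoundDiagonal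

section Sobolev

variable {d : ℕ} {s r : ℝ}

/-- The inverse weights, arranged in nonincreasing order along a bijection of `ℕ` with `ℤ^d`, are
square summable, with explicit asymptotics of the `ℓ²` norms of their tails. -/
theorem exists_equiv_tendsto_sqrt_tail (hd : 0 < d) (hs : (d : ℝ) / 2 < s) (hr : 0 < r) :
    (Summable fun k => ((wIso d s r k)⁻¹) ^ 2) ∧
    ∃ e : ℕ ≃ ZLat d, (Antitone fun j => (wIso d s r (e j))⁻¹) ∧
      Tendsto (fun n : ℕ => (n : ℝ) ^ (s / (d : ℝ) - 1 / 2) *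
        Real.sqrt (∑' j, ((wIso d s r (e (j + n)))⁻¹) ^ 2)) atTop
        (nhds (Real.sqrt ((d : ℝ) / (2 * s - d)) *
          (volume {x : Fin d → ℝ | ∑ j, |x j| ^ r ≤ 1}).toReal ^ (s / (d : ℝ)))) := by
  have hd' : (0 : ℝ) < d := by exact_mod_cast hd
  have hs0 : 0 < s := by linarith
  have hp : 1 < 2 * s / d := by rw [lt_div_iff₀ hd']; linarith
  obtain ⟨e, hmono, hlim⟩ := exists_rearrangement_wIso hd hs0 hr
  obtain ⟨hsum, htail⟩ := tendsto_rpow_mul_tsum_tail hp hlim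
  refine ⟨(e.summable_iff (f := fun k => ((wIso d s r k)⁻¹) ^ 2)).1 hsum, e,
    fun i j hij => inv_anti₀ (wIso_pos d s r _) (hmono hij), ?_⟩
  have h := htail.sqrt
  set V := (volume {x : Fin d → ℝ | ∑ j, |x j| ^ r ≤ 1}).toReal
  have hV : 0 ≤ V := ENNReal.toReal_nonneg
  have hconst : Real.sqrt (V ^ (2 * s / d) / (2 * s / d - 1)) =
      Real.sqrt ((d : ℝ) / (2 * s - d)) * V ^ (s / (d : ℝ)) := by
    have h1 : V ^ (2 * s / d) = (V ^ (s / (d : ℝ))) ^ 2 := by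
      rw [← Real.rpow_natCast, ← Real.rpow_mul hV]
      congr 1
      push_cast
      ring
    have h2 : (V ^ (s / (d : ℝ))) ^ 2 / (2 * s / d - 1) =
        d / (2 * s - d) * (V ^ (s / (d : ℝ))) ^ 2 := by
      have : 2 * s - d ≠ 0 := by linarith
      have : 2 * s / d - 1 ≠ 0 := by linarith
      field_simp
    rw [h1, h2, Real.sqrt_mul (div_nonneg hd'.le (by linarith)),
      Real.sqrt_sq (Real.rpow_nonneg hV _)]
  rw [hconst] at h
  refine h.congr fun n => ?_
  have h3 : (n : ℝ) ^ (2 * s / d - 1) = ((n : ℝ) ^ (s / (d : ℝ) - 1 / 2)) ^ 2 := by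
    rw [← Real.rpow_natCast, ← Real.rpow_mul n.cast_nonneg]
    congr 1
    push_cast
    ring
  rw [Real.sqrt_mul (Real.rpow_nonneg n.cast_nonneg _), h3,
    Real.sqrt_sq (Real.rpow_nonneg n.cast_nonneg _)]

/-- An index shift does not change power asymptotics. -/
theorem tendsto_rpow_mul_of_succ {p L : ℝ} {f a : ℕ → ℝ} (ha : ∀ n, a (n + 1) = f n)
    (hf : Tendsto (fun n : ℕ => (n : ℝ) ^ p * f n) atTop (nhds L)) :
    Tendsto (fun n : ℕ => (n : ℝ) ^ p * a n) atTop (nhds L) := by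
  refine (tendsto_add_atTop_iff_nat 1).1 ?_
  have h1 : Tendsto (fun n : ℕ => (1 + ((n : ℝ))⁻¹) ^ p) atTop (nhds 1) := by
    have : Tendsto (fun n : ℕ => 1 + ((n : ℝ))⁻¹) atTop (nhds 1) := by
      simpa using (tendsto_inv_atTop_nhds_zero_nat (𝕜 := ℝ)).const_add 1
    simpa using this.rpow_const (p := p) (Or.inl one_ne_zero)
  have h2 := h1.mul hf
  rw [one_mul] at h2
  refine h2.congr' ?_
  filter_upwards [eventually_gt_atTop 0] with n hn
  have hn' : (0 : ℝ) < n := by positivity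
  rw [ha, ← mul_assoc, ← Real.mul_rpow (by positivity) hn'.le, add_mul, one_mul,
    inv_mul_cancel₀ hn'.ne', Nat.cast_add, Nat.cast_one]

theorem norm_toLp_top_le (d : ℕ) :
    ‖(ContinuousMap.toLp ⊤ (torusMeasure d) ℂ : C(Torus d, ℂ) →L[ℂ] _)‖ ≤ 1 := by
  simpa using ContinuousMap.toLp_norm_le (p := ⊤) (E := ℂ) (μ := torusMeasure d) (𝕜 := ℂ)

end Sobolev

/-- Theorem 3 of Cobos–Kühn–Sickel. For `d ∈ ℕ`, `s > d/2` and
`0 < r < ∞`, `lim_{n→∞} n^{s/d-1/2} a_n(I_d : H^{s,r}(𝕋^d) → L_∞(𝕋^d))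
 = √(d/(2s-d)) vol(B_r^d)^{s/d}`, and the same limit holds with `L_∞(𝕋^d)` replaced
by `C(𝕋^d)` or by the Wiener algebra `A(𝕋^d)` (the latter modelled isometrically as
`ℓ¹` via Fourier coefficients). -/
theorem statement5 (d : ℕ) (hd : 0 < d) (s r : ℝ) (hs : (d : ℝ) / 2 < s) (hr : 0 < r) :
    ((∃ Ti : ellTwo d →L[ℂ] Lp ℂ ⊤ (torusMeasure d),
        ∀ (c : ellTwo d) (k : ZLat d), fourierCoef (⇑(Ti c)) k = c k / (wIso d s r k : ℂ)) ∧
     (∃ TC : ellTwo d →L[ℂ] C(Torus d, ℂ),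
        ∀ (c : ellTwo d) (k : ZLat d), fourierCoef (⇑(TC c)) k = c k / (wIso d s r k : ℂ)) ∧
     (∃ TA : ellTwo d →L[ℂ] ellOne d,
        ∀ (c : ellTwo d) (k : ZLat d), TA c k = c k / (wIso d s r k : ℂ))) ∧
    (∀ Ti : ellTwo d →L[ℂ] Lp ℂ ⊤ (torusMeasure d),
       (∀ (c : ellTwo d) (k : ZLat d), fourierCoef (⇑(Ti c)) k = c k / (wIso d s r k : ℂ)) →
       Tendsto (fun n : ℕ => (n : ℝ) ^ (s / (d : ℝ) - 1 / 2) * approxNum Ti n) atTop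
         (nhds (Real.sqrt ((d : ℝ) / (2 * s - d)) *
           (volume {x : Fin d → ℝ | ∑ j, |x j| ^ r ≤ 1}).toReal ^ (s / (d : ℝ))))) ∧
    (∀ TC : ellTwo d →L[ℂ] C(Torus d, ℂ),
       (∀ (c : ellTwo d) (k : ZLat d), fourierCoef (⇑(TC c)) k = c k / (wIso d s r k : ℂ)) →
       Tendsto (fun n : ℕ => (n : ℝ) ^ (s / (d : ℝ) - 1 / 2) * approxNum TC n) atTop
         (nhds (Real.sqrt ((d : ℝ) / (2 * s - d)) *
           (volume {x : Fin d → ℝ | ∑ j, |x j| ^ r ≤ 1}).toReal ^ (s / (d : ℝ))))) ∧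
    (∀ TA : ellTwo d →L[ℂ] ellOne d,
       (∀ (c : ellTwo d) (k : ZLat d), TA c k = c k / (wIso d s r k : ℂ)) →
       Tendsto (fun n : ℕ => (n : ℝ) ^ (s / (d : ℝ) - 1 / 2) * approxNum TA n) atTop
         (nhds (Real.sqrt ((d : ℝ) / (2 * s - d)) *
           (volume {x : Fin d → ℝ | ∑ j, |x j| ^ r ≤ 1}).toReal ^ (s / (d : ℝ))))) := by
  obtain ⟨hsum, e, hanti, hlim⟩ := exists_equiv_tendsto_sqrt_tail hd hs hr
  have hτ : ∀ k, 0 ≤ (wIso d s r k)⁻¹ := fun k => inv_nonneg.2 (wIso_pos d s r k).le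
  have hdiv : ∀ (z : ℂ) (k : ZLat d),
      (((wIso d s r k)⁻¹ : ℝ) : ℂ) * z = z / (wIso d s r k : ℂ) := fun z k => by
    rw [Complex.ofReal_inv, mul_comm, div_eq_mul_inv]
  let D : ellTwo d →L[ℂ] ellOne d := diagonalOp (fun k => (wIso d s r k)⁻¹) hτ hsum
  let J := ContinuousMap.toLp (E := ℂ) ⊤ (torusMeasure d) ℂ
  let DC : ellTwo d →L[ℂ] C(Torus d, ℂ) := (fourierSynthesis d).comp D
  let Di : ellTwo d →L[ℂ] Lp ℂ ⊤ (torusMeasure d) := J.comp DC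
  have hD : ∀ c k, D c k = c k / (wIso d s r k : ℂ) := fun c k => hdiv _ _
  have hDC : ∀ c k, fourierCoef (DC c) k = c k / (wIso d s r k : ℂ) := fun c k =>
    (fourierCoef_fourierSynthesis (D c) k).trans (hD c k)
  have hDi : ∀ c k, fourierCoef (Di c) k = c k / (wIso d s r k : ℂ) := fun c k =>
    (fourierCoef_toLp ⊤ (DC c) k).trans (hDC c k)
  have hDle := approxNum_diagonalOp_le (fun k => (wIso d s r k)⁻¹) hτ hsum e
  have hDCle := approxNum_comp_le (fourierSynthesis d) (norm_fourierSynthesis_le d) D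
  have hDile := approxNum_comp_le J (norm_toLp_top_le d) DC
  have hle := sqrt_tsum_le_approxNum hτ e hanti (T := Di) fun c k => by rw [hDi, hdiv]
  refine ⟨⟨⟨Di, hDi⟩, ⟨DC, hDC⟩, ⟨D, hD⟩⟩, fun T hT => ?_, fun T hT => ?_, fun T hT => ?_⟩
  · obtain rfl : T = Di := ContinuousLinearMap.ext fun c =>
      Lp_top_ext_fourierCoef fun k => by rw [hT, hDi]
    exact tendsto_rpow_mul_of_succ (fun n => le_antisymm
      ((hDile n).trans ((hDCle n).trans (hDle n))) (hle n)) hlim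
  · obtain rfl : T = DC := ContinuousLinearMap.ext fun c =>
      continuousMap_ext_fourierCoef fun k => by rw [hT, hDC]
    exact tendsto_rpow_mul_of_succ (fun n => le_antisymm
      ((hDCle n).trans (hDle n)) ((hle n).trans (hDile n))) hlim
  · obtain rfl : T = D := ContinuousLinearMap.ext fun c =>
      lp.ext (funext fun k => by rw [hT, hD])
    exact tendsto_rpow_mul_of_succ (fun n => le_antisymm (hDle n)
      ((hle n).trans ((hDile n).trans (hDCle n)))) hlim
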